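/- For every r > 2 there is a constant C depending only on r such that the following holds for all ε ∈ (0,1], t ∈ [0,ε], τ > 0. Let w̄ = (w̄_ξ)_{ξ∈ℝ} be a family of twice continuously differentiable functions w̄_ξ : [0,∞) → ℂ, and A = (A_ξ)_{ξ∈ℝ} ⊂ ℂ, for which all norms below are finite and all integrals converge absolutely. Define ∂_yℳ_ξ(y) = −i∫_ℝ ( η A_η θ_η(y) ∂_y w̄_{ξ−η}(y) + η A_η I_y[θ_η] ∂_{yy} w̄_{ξ−η}(y) ) dη and T_{∂yℳ} = ∫_ℝ∫_0^∞ ∂_yℳ_ξ(y) conj(∂_y w̄_ξ(y)) χ(y)² ρ(y)² e^{2τ|ξ|} ⟨ξ⟩^{2r−1} dy dξ. Then |T_{∂yℳ}| ≤ C ( ‖χ∂_y w̄‖²_{τ,r−1/2} ‖|∂ₓ|^{1/2} A‖~_{τ,r} + ‖yχ∂_y w̄‖_{τ,r−1/2} ‖χ∂_{yy} w̄‖_{τ,r−1/2} ‖|∂ₓ|^{1/2} A‖~_{τ,r} ). -/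

import Mathlib

open MeasureTheory Set Filter

noncomputable section

/-- Gaussian weight `ρ(y) = exp(y²/(8(1+t/ε)))`. -/
def rho (ε t y : ℝ) : ℝ := Real.exp (y ^ 2 / (8 * (1 + t / ε)))

/-- Japanese bracket `⟨ξ⟩ = √(1+ξ²)`. -/
def brak (ξ : ℝ) : ℝ := Real.sqrt (1 + ξ ^ 2)

/-- Combined weight `ρ(y)² e^{2τ|ξ|} ⟨ξ⟩^{2s}` in the squared analytic norms. -/
def wgt (ε t τ s ξ y : ℝ) : ℝ :=
  (rho ε t y) ^ 2 * Real.exp (2 * τ * |ξ|) * brak ξ ^ (2 * s)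

/-- Weight `e^{2τ|ξ|} ⟨ξ⟩^{2s}` for the squared analytic norms of boundary data. -/
def aWgt (τ s ξ : ℝ) : ℝ := Real.exp (2 * τ * |ξ|) * brak ξ ^ (2 * s)

/-- Analytic norm `‖w‖_{τ,s}` (with Fourier multiplier `m`):
`(∫_ℝ ∫_0^∞ m(ξ) ρ(y)² |w_ξ(y)|² e^{2τ|ξ|} ⟨ξ⟩^{2s} dy dξ)^{1/2}`. -/
def wNorm (ε t τ s : ℝ) (m : ℝ → ℝ) (w : ℝ → ℝ → ℂ) : ℝ :=
  Real.sqrt (∫ ξ : ℝ, ∫ y in Ioi (0 : ℝ), m ξ * ‖w ξ y‖ ^ 2 * wgt ε t τ s ξ y)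

/-- Analytic norm `‖A‖~_{τ,s}` (with Fourier multiplier `m`):
`(∫_ℝ m(ξ) |A_ξ|² e^{2τ|ξ|} ⟨ξ⟩^{2s} dξ)^{1/2}`. -/
def aNorm (τ s : ℝ) (m : ℝ → ℝ) (A : ℝ → ℂ) : ℝ :=
  Real.sqrt (∫ ξ : ℝ, m ξ * ‖A ξ‖ ^ 2 * aWgt τ s ξ)

/-- Finiteness of the squared norm `‖·‖_{τ,s}` with multiplier `m`. -/
def wFinite (ε t τ s : ℝ) (m : ℝ → ℝ) (w : ℝ → ℝ → ℂ) : Prop :=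
  Integrable (fun p : ℝ × ℝ => m p.1 * ‖w p.1 p.2‖ ^ 2 * wgt ε t τ s p.1 p.2)
    ((volume : Measure ℝ).prod ((volume : Measure ℝ).restrict (Ioi 0)))

/-- Finiteness of the squared norm `‖·‖~_{τ,s}` with multiplier `m`. -/
def aFinite (τ s : ℝ) (m : ℝ → ℝ) (A : ℝ → ℂ) : Prop :=
  Integrable (fun ξ : ℝ => m ξ * ‖A ξ‖ ^ 2 * aWgt τ s ξ) (volume : Measure ℝ)

/-- Lift function `θ_ξ(y) = 1 − exp(−y²⟨ξ⟩²/(2(1+t/ε)))`. -/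
def theta (ε t ξ y : ℝ) : ℝ :=
  1 - Real.exp (-(y ^ 2 * (1 + ξ ^ 2)) / (2 * (1 + t / ε)))

/-- `I_y[h] = ∫_0^y h` (real-valued version). -/
def IyR (h : ℝ → ℝ) (y : ℝ) : ℝ := ∫ y' in (0 : ℝ)..y, h y'

/-- The differentiated linear term
`∂_yℳ_ξ(y) = −i∫ (η A_η θ_η ∂_y w̄_{ξ−η} + η A_η I_y[θ_η] ∂_{yy} w̄_{ξ−η}) dη`. -/
def dyMcal (ε t : ℝ) (w : ℝ → ℝ → ℂ) (A : ℝ → ℂ) (ξ y : ℝ) : ℂ :=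
  -Complex.I * ∫ η : ℝ,
    ((η : ℂ) * A η * ((theta ε t η y : ℝ) : ℂ) * deriv (w (ξ - η)) y
      + (η : ℂ) * A η * ((IyR (theta ε t η) y : ℝ) : ℂ) * deriv (deriv (w (ξ - η))) y)


lemma core_meas (k : ℝ → ℝ → ℝ) (hk : Continuous (Function.uncurry k))
    (a : ℝ → ℝ) (ha : Integrable a) (ν : Measure ℝ) [SFinite ν]
    (U V : ℝ → ℝ → ℝ) (hU : Integrable (fun p : ℝ × ℝ => U p.1 p.2) ((volume : Measure ℝ).prod ν))
    (hV : Integrable (fun p : ℝ × ℝ => V p.1 p.2) ((volume : Measure ℝ).prod ν)) :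
    AEMeasurable (fun q : ℝ × ℝ × ℝ => ENNReal.ofReal (Real.sqrt (k q.1 q.2.1 * V q.1 q.2.2) *
        Real.sqrt (a q.2.1 * U (q.1 - q.2.1) q.2.2))) ((volume : Measure ℝ).prod
          ((volume : Measure ℝ).prod ν)) := by
  set P := (volume : Measure ℝ).prod ((volume : Measure ℝ).prod ν) with hP
  have hVm : AEMeasurable (fun p : ℝ × ℝ => V p.1 p.2)
      ((volume : Measure ℝ).prod ν) := hV.aemeasurable
  have hUm : AEMeasurable (fun p : ℝ × ℝ => U p.1 p.2)
      ((volume : Measure ℝ).prod ν) := hU.aemeasurable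
  have ham : AEMeasurable (fun η : ℝ => a η) volume :=
    ha.aemeasurable
  have qV : Measure.QuasiMeasurePreserving (fun q : ℝ × ℝ × ℝ => (q.1, q.2.2)) P
      ((volume : Measure ℝ).prod ν) :=
    QuasiMeasurePreserving.prodMap (Measure.QuasiMeasurePreserving.id _)
      Measure.quasiMeasurePreserving_snd
  have qA : Measure.QuasiMeasurePreserving (fun q : ℝ × ℝ × ℝ => q.2.1) P
      (volume : Measure ℝ) :=
    Measure.quasiMeasurePreserving_fst.comp Measure.quasiMeasurePreserving_snd
  have qU : Measure.QuasiMeasurePreserving (fun q : ℝ × ℝ × ℝ => (q.1 - q.2.1, q.2.2)) P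
      ((volume : Measure ℝ).prod ν) := by
    refine QuasiMeasurePreserving.prod_of_right (by fun_prop) ?_
    refine Filter.Eventually.of_forall fun ξ => ?_
    exact QuasiMeasurePreserving.prodMap (quasiMeasurePreserving_sub_left volume ξ)
      (Measure.QuasiMeasurePreserving.id _)
  have hV3 : AEMeasurable (fun q : ℝ × ℝ × ℝ => V q.1 q.2.2) P :=
    hVm.comp_quasiMeasurePreserving qV
  have hU3 : AEMeasurable (fun q : ℝ × ℝ × ℝ => U (q.1 - q.2.1) q.2.2) P :=
    hUm.comp_quasiMeasurePreserving qU
  have hA3 : AEMeasurable (fun q : ℝ × ℝ × ℝ => a q.2.1) P :=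
    ham.comp_quasiMeasurePreserving qA
  have hk3 : Measurable (fun q : ℝ × ℝ × ℝ => k q.1 q.2.1) := by
    have : Continuous (fun q : ℝ × ℝ × ℝ => k q.1 q.2.1) :=
      hk.comp (by fun_prop : Continuous (fun q : ℝ × ℝ × ℝ => (q.1, q.2.1)))
    exact this.measurable
  exact ((hk3.aemeasurable.mul hV3).sqrt.mul (hA3.mul hU3).sqrt).ennreal_ofReal

lemma core_bound (k : ℝ → ℝ → ℝ) (hk : Continuous (Function.uncurry k)) (hk0 : ∀ x y, 0 ≤ k x y)
    (M : ℝ) (hM0 : 0 ≤ M) (hM : ∀ ξ, ∫⁻ η, ENNReal.ofReal (k ξ η) ≤ ENNReal.ofReal M)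
    (a : ℝ → ℝ) (ha : Integrable a) (ha0 : ∀ x, 0 ≤ a x)
    (ν : Measure ℝ) [SFinite ν]
    (U V : ℝ → ℝ → ℝ) (hU : Integrable (fun p : ℝ × ℝ => U p.1 p.2) ((volume : Measure ℝ).prod ν))
    (hV : Integrable (fun p : ℝ × ℝ => V p.1 p.2) ((volume : Measure ℝ).prod ν))
    (hU0 : ∀ x y, 0 ≤ U x y) (hV0 : ∀ x y, 0 ≤ V x y) :
    ∫⁻ q : ℝ × ℝ × ℝ, ENNReal.ofReal (Real.sqrt (k q.1 q.2.1 * V q.1 q.2.2) *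
        Real.sqrt (a q.2.1 * U (q.1 - q.2.1) q.2.2)) ∂((volume : Measure ℝ).prod
          ((volume : Measure ℝ).prod ν))
      ≤ ENNReal.ofReal (Real.sqrt M * Real.sqrt (∫ ξ, ∫ y, V ξ y ∂ν) *
          (Real.sqrt (∫ ξ, a ξ) * Real.sqrt (∫ ξ, ∫ y, U ξ y ∂ν))) := by
  set P := (volume : Measure ℝ).prod ((volume : Measure ℝ).prod ν) with hP
  have hVm : AEMeasurable (fun p : ℝ × ℝ => ENNReal.ofReal (V p.1 p.2))
      ((volume : Measure ℝ).prod ν) := hV.aemeasurable.ennreal_ofReal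
  have hUm : AEMeasurable (fun p : ℝ × ℝ => ENNReal.ofReal (U p.1 p.2))
      ((volume : Measure ℝ).prod ν) := hU.aemeasurable.ennreal_ofReal
  have ham : AEMeasurable (fun η : ℝ => ENNReal.ofReal (a η)) volume :=
    ha.aemeasurable.ennreal_ofReal
  have qV : Measure.QuasiMeasurePreserving (fun q : ℝ × ℝ × ℝ => (q.1, q.2.2)) P
      ((volume : Measure ℝ).prod ν) :=
    QuasiMeasurePreserving.prodMap (Measure.QuasiMeasurePreserving.id _)
      Measure.quasiMeasurePreserving_snd
  have qA : Measure.QuasiMeasurePreserving (fun q : ℝ × ℝ × ℝ => q.2.1) P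
      (volume : Measure ℝ) :=
    Measure.quasiMeasurePreserving_fst.comp Measure.quasiMeasurePreserving_snd
  have qU : Measure.QuasiMeasurePreserving (fun q : ℝ × ℝ × ℝ => (q.1 - q.2.1, q.2.2)) P
      ((volume : Measure ℝ).prod ν) := by
    refine QuasiMeasurePreserving.prod_of_right (by fun_prop) ?_
    refine Filter.Eventually.of_forall fun ξ => ?_
    exact QuasiMeasurePreserving.prodMap (quasiMeasurePreserving_sub_left volume ξ)
      (Measure.QuasiMeasurePreserving.id _)
  have hV3 : AEMeasurable (fun q : ℝ × ℝ × ℝ => ENNReal.ofReal (V q.1 q.2.2)) P :=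
    hVm.comp_quasiMeasurePreserving qV
  have hU3 : AEMeasurable (fun q : ℝ × ℝ × ℝ => ENNReal.ofReal (U (q.1 - q.2.1) q.2.2)) P :=
    hUm.comp_quasiMeasurePreserving qU
  have hA3 : AEMeasurable (fun q : ℝ × ℝ × ℝ => ENNReal.ofReal (a q.2.1)) P :=
    ham.comp_quasiMeasurePreserving qA
  have hk3 : Measurable (fun q : ℝ × ℝ × ℝ => ENNReal.ofReal (k q.1 q.2.1)) := by
    have : Continuous (fun q : ℝ × ℝ × ℝ => k q.1 q.2.1) :=
      hk.comp (by fun_prop : Continuous (fun q : ℝ × ℝ × ℝ => (q.1, q.2.1)))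
    exact this.measurable.ennreal_ofReal
  have hVi : ∫⁻ p : ℝ × ℝ, ENNReal.ofReal (V p.1 p.2) ∂((volume : Measure ℝ).prod ν)
      = ENNReal.ofReal (∫ ξ, ∫ y, V ξ y ∂ν) := by
    rw [← ofReal_integral_eq_lintegral_ofReal hV (Filter.Eventually.of_forall fun p => hV0 _ _),
      integral_prod _ hV]
  have hUi : ∫⁻ p : ℝ × ℝ, ENNReal.ofReal (U p.1 p.2) ∂((volume : Measure ℝ).prod ν)
      = ENNReal.ofReal (∫ ξ, ∫ y, U ξ y ∂ν) := by
    rw [← ofReal_integral_eq_lintegral_ofReal hU (Filter.Eventually.of_forall fun p => hU0 _ _),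
      integral_prod _ hU]
  have hai : ∫⁻ η, ENNReal.ofReal (a η) = ENNReal.ofReal (∫ ξ, a ξ) := by
    rw [← ofReal_integral_eq_lintegral_ofReal ha (Filter.Eventually.of_forall ha0)]
  have e1 : ∫⁻ q, ENNReal.ofReal (k q.1 q.2.1) * ENNReal.ofReal (V q.1 q.2.2) ∂P
      ≤ ENNReal.ofReal M * ENNReal.ofReal (∫ ξ, ∫ y, V ξ y ∂ν) := by
    have hmm : AEMeasurable (fun q : ℝ × ℝ × ℝ => ENNReal.ofReal (k q.1 q.2.1) *
        ENNReal.ofReal (V q.1 q.2.2)) P := hk3.aemeasurable.mul hV3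
    rw [hP, lintegral_prod _ hmm, ← hVi, lintegral_prod _ hVm,
      ← lintegral_const_mul' _ _ ENNReal.ofReal_ne_top]
    refine lintegral_mono_ae ?_
    filter_upwards [hV.prod_right_ae] with ξ hξ
    have hkm : Measurable (fun η => ENNReal.ofReal (k ξ η)) := by
      have : Continuous (fun η => k ξ η) :=
        hk.comp (by fun_prop : Continuous (fun η : ℝ => (ξ, η)))
      exact this.measurable.ennreal_ofReal
    have := lintegral_prod_mul (μ := (volume : Measure ℝ)) (ν := ν) hkm.aemeasurable
      (hξ.aemeasurable.ennreal_ofReal)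
    rw [this]
    gcongr
    exact hM ξ
  have e2 : ∫⁻ q, ENNReal.ofReal (a q.2.1) * ENNReal.ofReal (U (q.1 - q.2.1) q.2.2) ∂P
      ≤ ENNReal.ofReal (∫ ξ, a ξ) * ENNReal.ofReal (∫ ξ, ∫ y, U ξ y ∂ν) := by
    have hmm : AEMeasurable (fun q : ℝ × ℝ × ℝ => ENNReal.ofReal (a q.2.1) *
        ENNReal.ofReal (U (q.1 - q.2.1) q.2.2)) P := hA3.mul hU3
    rw [hP, lintegral_prod_symm _ hmm, ← hUi, lintegral_prod_symm _ hUm, ← hai,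
      ← lintegral_prod_mul ham hUm.lintegral_prod_left']
    refine lintegral_mono fun p => ?_
    simp only
    rw [lintegral_const_mul' _ _ ENNReal.ofReal_ne_top,
      lintegral_sub_right_eq_self (fun x => ENNReal.ofReal (U x p.2)) p.1]
  have hs : ∀ x : ℝ, ENNReal.ofReal (Real.sqrt x) = (ENNReal.ofReal x) ^ (1 / 2 : ℝ) := by
    intro x
    rcases le_total 0 x with h | h
    · rw [Real.sqrt_eq_rpow, ENNReal.ofReal_rpow_of_nonneg h (by norm_num)]
    · rw [Real.sqrt_eq_zero_of_nonpos h, ENNReal.ofReal_of_nonpos h]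
      simp
  calc _ = ∫⁻ q, (((fun q : ℝ × ℝ × ℝ => (ENNReal.ofReal (k q.1 q.2.1) *
            ENNReal.ofReal (V q.1 q.2.2)) ^ (1 / 2 : ℝ)) *
          (fun q : ℝ × ℝ × ℝ => (ENNReal.ofReal (a q.2.1) *
            ENNReal.ofReal (U (q.1 - q.2.1) q.2.2)) ^ (1 / 2 : ℝ))) q) ∂P := by
        refine lintegral_congr fun q => ?_
        simp only [Pi.mul_apply]
        rw [ENNReal.ofReal_mul (Real.sqrt_nonneg _), hs, hs, ENNReal.ofReal_mul (hk0 _ _),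
          ENNReal.ofReal_mul (ha0 _)]
    _ ≤ _ := ENNReal.lintegral_mul_le_Lp_mul_Lq P
          (Real.HolderConjugate.two_two) ((hk3.aemeasurable.mul hV3).pow_const _)
          ((hA3.mul hU3).pow_const _)
    _ ≤ _ := by
        have h2 : ∀ x : ENNReal, (x ^ (1 / 2 : ℝ)) ^ (2 : ℝ) = x := by
          intro x
          rw [← ENNReal.rpow_mul]; norm_num
        simp only [h2]
        rw [ENNReal.ofReal_mul (mul_nonneg (Real.sqrt_nonneg _) (Real.sqrt_nonneg _)),
          ENNReal.ofReal_mul (Real.sqrt_nonneg _), ENNReal.ofReal_mul (Real.sqrt_nonneg _), hs, hs, hs, hs,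
          ← ENNReal.mul_rpow_of_nonneg (ENNReal.ofReal M) _ (by norm_num : (0 : ℝ) ≤ 1 / 2),
          ← ENNReal.mul_rpow_of_nonneg (ENNReal.ofReal (∫ ξ, a ξ)) _ (by norm_num : (0 : ℝ) ≤ 1 / 2)]
        exact mul_le_mul' (ENNReal.rpow_le_rpow e1 (by norm_num : (0 : ℝ) ≤ 1 / 2))
          (ENNReal.rpow_le_rpow e2 (by norm_num : (0 : ℝ) ≤ 1 / 2))

lemma brak_pos (x : ℝ) : 0 < brak x := by unfold brak; positivity

lemma one_le_brak (x : ℝ) : 1 ≤ brak x := by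
  unfold brak; rw [Real.one_le_sqrt]; nlinarith [sq_nonneg x]

lemma abs_le_brak (x : ℝ) : |x| ≤ brak x := by
  unfold brak; apply Real.abs_le_sqrt; linarith

lemma brak_add (x y : ℝ) : brak (x + y) ≤ brak x + brak y := by
  have hx := brak_pos x
  have hy := brak_pos y
  have h1 : brak x ^ 2 = 1 + x ^ 2 := Real.sq_sqrt (by positivity)
  have h2 : brak y ^ 2 = 1 + y ^ 2 := Real.sq_sqrt (by positivity)
  have h3 : |x| * |y| ≤ brak x * brak y :=
    mul_le_mul (abs_le_brak x) (abs_le_brak y) (abs_nonneg _) hx.le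
  rw [← abs_mul] at h3
  have h4 := le_abs_self (x * y)
  unfold brak at h1 h2 h3 hx hy ⊢
  rw [Real.sqrt_le_left (by positivity)]
  nlinarith

lemma brak_pow_le (p : ℝ) (hp : 0 ≤ p) (ξ η : ℝ) :
    brak ξ ^ p ≤ 2 ^ p * (brak η ^ p + brak (ξ - η) ^ p) := by
  have h := brak_add η (ξ - η)
  rw [add_sub_cancel] at h
  have hx := brak_pos η
  have hy := brak_pos (ξ - η)
  have h0 := brak_pos ξ
  have px := Real.rpow_pos_of_pos hx p
  have py := Real.rpow_pos_of_pos hy p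
  rcases le_total (brak η) (brak (ξ - η)) with h' | h'
  · calc brak ξ ^ p ≤ (2 * brak (ξ - η)) ^ p :=
          Real.rpow_le_rpow h0.le (by linarith) hp
      _ = 2 ^ p * brak (ξ - η) ^ p := Real.mul_rpow (by norm_num) hy.le
      _ ≤ _ := by gcongr; linarith
  · calc brak ξ ^ p ≤ (2 * brak η) ^ p :=
          Real.rpow_le_rpow h0.le (by linarith) hp
      _ = 2 ^ p * brak η ^ p := Real.mul_rpow (by norm_num) hx.le
      _ ≤ _ := by gcongr; linarith

lemma brak_integrable (p : ℝ) (hp : 1 < p) : Integrable (fun x => brak x ^ (-p)) := by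
  have h := integrable_rpow_neg_one_add_norm_sq (E := ℝ) (μ := volume) (r := p) (by simpa using hp)
  refine h.congr (Filter.Eventually.of_forall fun x => ?_)
  simp only [brak, Real.norm_eq_abs, sq_abs]
  rw [Real.sqrt_eq_rpow, ← Real.rpow_mul (by positivity)]
  congr 1; ring

def kern (p ξ η : ℝ) : ℝ := 2 ^ p * (brak η ^ (-p) + brak (ξ - η) ^ (-p))

lemma kern_nonneg (p ξ η : ℝ) : 0 ≤ kern p ξ η := by
  have := brak_pos η
  have := brak_pos (ξ - η)
  unfold kern; positivity

lemma brak_cont : Continuous brak := by unfold brak; fun_prop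

lemma kern_cont (p : ℝ) : Continuous (Function.uncurry (kern p)) := by
  have hc : Continuous (fun x => brak x ^ (-p)) :=
    brak_cont.rpow_const (fun x => Or.inl (brak_pos x).ne')
  have h1 : Continuous (fun q : ℝ × ℝ => brak q.2 ^ (-p)) := hc.comp continuous_snd
  have h2 : Continuous (fun q : ℝ × ℝ => brak (q.1 - q.2) ^ (-p)) :=
    hc.comp (continuous_fst.sub continuous_snd)
  exact continuous_const.mul (h1.add h2)

lemma kern_int (p : ℝ) (hp : 1 < p) (ξ : ℝ) :
    ∫⁻ η, ENNReal.ofReal (kern p ξ η) ≤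
      ENNReal.ofReal (2 ^ p * (2 * ∫ x, brak x ^ (-p))) := by
  have h := brak_integrable p hp
  have h' : Integrable (fun η => brak (ξ - η) ^ (-p)) := h.comp_sub_left ξ
  have hi : Integrable (fun η => kern p ξ η) := (h.add h').const_mul _
  rw [← ofReal_integral_eq_lintegral_ofReal hi (Filter.Eventually.of_forall fun _ => kern_nonneg _ _ _)]
  apply le_of_eq
  congr 1
  unfold kern
  rw [integral_const_mul, integral_add h h', integral_sub_left_eq_self (fun x => brak x ^ (-p))]
  ring

lemma wgt_le (r τ ξ η : ℝ) (hr : 2 < r) (hτ : 0 < τ) (ε t y : ℝ) :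
    |η| * wgt ε t τ (r - 1 / 2) ξ y ≤
      kern (2 * (r - 1 / 2)) ξ η * aWgt τ r η * wgt ε t τ (r - 1 / 2) (ξ - η) y := by
  have hx := brak_pos η
  have hy := brak_pos (ξ - η)
  set p := 2 * (r - 1 / 2) with hp
  have h1 := brak_pow_le p (by rw [hp]; linarith) ξ η
  have h2 := abs_le_brak η
  have h3 : Real.exp (2 * τ * |ξ|) ≤ Real.exp (2 * τ * |η|) * Real.exp (2 * τ * |ξ - η|) := by
    rw [← Real.exp_add, ← mul_add]
    apply Real.exp_le_exp.2
    have : |ξ| ≤ |η| + |ξ - η| := by simpa using abs_add_le η (ξ - η)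
    gcongr
  have e : kern p ξ η * brak η ^ (2 * r) * brak (ξ - η) ^ p =
      brak η * (2 ^ p * (brak η ^ p + brak (ξ - η) ^ p)) := by
    have : 2 * r = p + 1 := by rw [hp]; ring
    unfold kern
    rw [this, Real.rpow_add hx, Real.rpow_one, Real.rpow_neg hx.le, Real.rpow_neg hy.le]
    have := (Real.rpow_pos_of_pos hx p).ne'
    have := (Real.rpow_pos_of_pos hy p).ne'
    field_simp
    ring
  unfold wgt aWgt
  rw [← hp]
  have b0 := Real.rpow_pos_of_pos (brak_pos ξ) p
  calc |η| * (rho ε t y ^ 2 * Real.exp (2 * τ * |ξ|) * brak ξ ^ p)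
      ≤ brak η * (rho ε t y ^ 2 * (Real.exp (2 * τ * |η|) * Real.exp (2 * τ * |ξ - η|)) *
          (2 ^ p * (brak η ^ p + brak (ξ - η) ^ p))) := by gcongr
    _ = rho ε t y ^ 2 * (Real.exp (2 * τ * |η|) * Real.exp (2 * τ * |ξ - η|)) *
        (brak η * (2 ^ p * (brak η ^ p + brak (ξ - η) ^ p))) := by ring
    _ = _ := by rw [← e]; ring

lemma wgt_nonneg (ε t τ s ξ y : ℝ) : 0 ≤ wgt ε t τ s ξ y := by
  have := brak_pos ξ
  unfold wgt; positivity

lemma aWgt_nonneg (τ s ξ : ℝ) : 0 ≤ aWgt τ s ξ := by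
  have := brak_pos ξ
  unfold aWgt; positivity

/-- pointwise estimate -/
lemma pt (k W0 W1 aw e a u v c d : ℝ) (hk : 0 ≤ k) (haw : 0 ≤ aw) (hW0 : 0 ≤ W0) (hW1 : 0 ≤ W1)
    (he : 0 ≤ e) (ha : 0 ≤ a) (hu : 0 ≤ u) (hv : 0 ≤ v) (hc : 0 ≤ c) (hd : 0 ≤ d)
    (h : e * W0 ≤ k * aw * W1) :
    e * a * u * v * (c * d * W0) ≤
      Real.sqrt (k * (1 * (d * v) ^ 2 * W0)) * Real.sqrt (e * a ^ 2 * aw * (1 * (c * u) ^ 2 * W1)) := by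
  rw [← Real.sqrt_mul (by positivity)]
  apply Real.le_sqrt_of_sq_le
  calc (e * a * u * v * (c * d * W0)) ^ 2
      = (e * (a * u * v * c * d) ^ 2 * W0) * (e * W0) := by ring
    _ ≤ (e * (a * u * v * c * d) ^ 2 * W0) * (k * aw * W1) := by gcongr
    _ = _ := by ring

lemma theta_bd (ε t ξ y : ℝ) (hε : 0 < ε) (ht : 0 ≤ t) : |theta ε t ξ y| ≤ 1 := by
  have h : 0 ≤ t / ε := by positivity
  unfold theta
  have h1 := Real.exp_pos (-(y ^ 2 * (1 + ξ ^ 2)) / (2 * (1 + t / ε)))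
  have h2 : Real.exp (-(y ^ 2 * (1 + ξ ^ 2)) / (2 * (1 + t / ε))) ≤ 1 := by
    rw [Real.exp_le_one_iff, neg_div]
    have : 0 ≤ (y ^ 2 * (1 + ξ ^ 2)) / (2 * (1 + t / ε)) := by positivity
    linarith
  rw [abs_le]; constructor <;> linarith

lemma Iy_bd (ε t ξ y : ℝ) (hε : 0 < ε) (ht : 0 ≤ t) (hy : 0 < y) :
    |IyR (theta ε t ξ) y| ≤ y := by
  have := intervalIntegral.norm_integral_le_of_norm_le_const (a := 0) (b := y) (C := 1)
    (f := theta ε t ξ) (fun x _ => theta_bd ε t ξ x hε ht)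
  simpa [IyR, abs_of_pos hy] using this

/-- passing the norm inside -/
lemma norm_inside (f : ℝ × ℝ × ℝ → ℂ) (ν : Measure ℝ) [SFinite ν]
    (hf : Integrable f ((volume : Measure ℝ).prod ((volume : Measure ℝ).prod ν))) :
    ‖∫ ξ : ℝ, ∫ y, (-Complex.I * ∫ η : ℝ, f (ξ, η, y)) ∂ν‖ₑ ≤
      ∫⁻ q, ‖f q‖ₑ ∂((volume : Measure ℝ).prod ((volume : Measure ℝ).prod ν)) := by
  rw [lintegral_prod _ hf.1.enorm]
  refine (enorm_integral_le_lintegral_enorm _).trans ?_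
  refine lintegral_mono_ae ?_
  filter_upwards [hf.prod_right_ae] with ξ hξ
  rw [lintegral_prod_symm _ hξ.1.enorm]
  refine (enorm_integral_le_lintegral_enorm _).trans ?_
  refine lintegral_mono fun y => ?_
  rw [enorm_mul]
  have : ‖-Complex.I‖ₑ = 1 := by
    rw [← ofReal_norm]; simp
  rw [this, one_mul]
  exact enorm_integral_le_lintegral_enorm _

/-- **Bound (3.18c) of the paper** on
`T_{∂yℳ} = ∫∫ ∂_yℳ_ξ conj(∂_y w̄_ξ) χ² ρ² e^{2τ|ξ|}⟨ξ⟩^{2r−1} dy dξ`. -/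
theorem TdyM_bound :
    ∀ r : ℝ, 2 < r →
    ∃ C : ℝ, 0 < C ∧
    ∀ (ε t τ : ℝ), 0 < ε → ε ≤ 1 → 0 ≤ t → t ≤ ε → 0 < τ →
    ∀ χ : ℝ → ℝ, ContDiff ℝ (⊤ : ℕ∞) χ →
      (∀ y : ℝ, 0 ≤ χ y ∧ χ y ≤ 1) →
      (∀ y : ℝ, y ≤ 1 → χ y = 0) →
      (∀ y : ℝ, 6 ≤ y → χ y = 1) →
      (∀ y : ℝ, 0 ≤ deriv χ y ∧ deriv χ y ≤ 1) →
    ∀ (w : ℝ → ℝ → ℂ) (A : ℝ → ℂ),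
      (∀ ξ : ℝ, ContDiffOn ℝ 2 (w ξ) (Ici 0)) →
      wFinite ε t τ (r - 1 / 2) (fun _ => 1) (fun ξ y => ((χ y : ℝ) : ℂ) * deriv (w ξ) y) →
      wFinite ε t τ (r - 1 / 2) (fun _ => 1)
        (fun ξ y => ((y * χ y : ℝ) : ℂ) * deriv (w ξ) y) →
      wFinite ε t τ (r - 1 / 2) (fun _ => 1)
        (fun ξ y => ((χ y : ℝ) : ℂ) * deriv (deriv (w ξ)) y) →
      aFinite τ r (fun ξ => |ξ|) A →
      Integrable (fun q : ℝ × ℝ × ℝ =>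
        ((q.2.1 : ℂ) * A q.2.1 * ((theta ε t q.2.1 q.2.2 : ℝ) : ℂ) *
              deriv (w (q.1 - q.2.1)) q.2.2
            + (q.2.1 : ℂ) * A q.2.1 * ((IyR (theta ε t q.2.1) q.2.2 : ℝ) : ℂ) *
              deriv (deriv (w (q.1 - q.2.1))) q.2.2) *
          (starRingEnd ℂ) (deriv (w q.1) q.2.2) *
          (((χ q.2.2) ^ 2 * wgt ε t τ (r - 1 / 2) q.1 q.2.2 : ℝ) : ℂ))
        ((volume : Measure ℝ).prod
          ((volume : Measure ℝ).prod ((volume : Measure ℝ).restrict (Ioi 0)))) →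
      ‖∫ ξ : ℝ, ∫ y in Ioi (0 : ℝ),
          dyMcal ε t w A ξ y * (starRingEnd ℂ) (deriv (w ξ) y) *
            (((χ y) ^ 2 * wgt ε t τ (r - 1 / 2) ξ y : ℝ) : ℂ)‖
        ≤ C * ((wNorm ε t τ (r - 1 / 2) (fun _ => 1)
                (fun ξ y => ((χ y : ℝ) : ℂ) * deriv (w ξ) y)) ^ 2 *
              aNorm τ r (fun ξ => |ξ|) A
            + wNorm ε t τ (r - 1 / 2) (fun _ => 1)
                (fun ξ y => ((y * χ y : ℝ) : ℂ) * deriv (w ξ) y) *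
              wNorm ε t τ (r - 1 / 2) (fun _ => 1)
                (fun ξ y => ((χ y : ℝ) : ℂ) * deriv (deriv (w ξ)) y) *
              aNorm τ r (fun ξ => |ξ|) A) := by
  intro r hr
  set J := ∫ x, brak x ^ (-(2 * (r - 1 / 2))) with hJ
  set M : ℝ := 2 ^ (2 * (r - 1 / 2)) * (2 * J) with hM
  have hJ0 : 0 ≤ J := integral_nonneg fun x => (Real.rpow_pos_of_pos (brak_pos x) _).le
  have hM0 : 0 ≤ M := by positivity
  refine ⟨Real.sqrt M + 1, by positivity, ?_⟩
  intro ε t τ hε _ ht _ hτ χ _ hχ _ _ _ w A _ hw1 hw2 hw3 hA hint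
  set a : ℝ → ℝ := fun ξ => |ξ| * ‖A ξ‖ ^ 2 * aWgt τ r ξ with ha
  have ha0 : ∀ x, 0 ≤ a x := fun x => by
    have := aWgt_nonneg τ r x
    simp only [ha]; positivity
  set U1 : ℝ → ℝ → ℝ := fun ξ y =>
    1 * ‖((χ y : ℝ) : ℂ) * deriv (w ξ) y‖ ^ 2 * wgt ε t τ (r - 1 / 2) ξ y with hU1
  set V2 : ℝ → ℝ → ℝ := fun ξ y =>
    1 * ‖((y * χ y : ℝ) : ℂ) * deriv (w ξ) y‖ ^ 2 * wgt ε t τ (r - 1 / 2) ξ y with hV2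
  set U2 : ℝ → ℝ → ℝ := fun ξ y =>
    1 * ‖((χ y : ℝ) : ℂ) * deriv (deriv (w ξ)) y‖ ^ 2 * wgt ε t τ (r - 1 / 2) ξ y with hU2
  have hU10 : ∀ x y, 0 ≤ U1 x y := fun x y => by
    have := wgt_nonneg ε t τ (r - 1 / 2) x y
    simp only [hU1]; positivity
  have hU20 : ∀ x y, 0 ≤ U2 x y := fun x y => by
    have := wgt_nonneg ε t τ (r - 1 / 2) x y
    simp only [hU2]; positivity
  have hV20 : ∀ x y, 0 ≤ V2 x y := fun x y => by
    have := wgt_nonneg ε t τ (r - 1 / 2) x y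
    simp only [hV2]; positivity
  set ν := (volume : Measure ℝ).restrict (Ioi 0) with hν
  have hp : 1 < 2 * (r - 1 / 2) := by linarith
  have c1 := core_bound (kern (2 * (r - 1 / 2))) (kern_cont _) (kern_nonneg _) M hM0
    (kern_int _ hp) a hA ha0 ν U1 U1 hw1 hw1 hU10 hU10
  have c2 := core_bound (kern (2 * (r - 1 / 2))) (kern_cont _) (kern_nonneg _) M hM0
    (kern_int _ hp) a hA ha0 ν U2 V2 hw3 hw2 hU20 hV20
  have hn := norm_inside _ ν hint
  have hA' : aNorm τ r (fun ξ => |ξ|) A = Real.sqrt (∫ ξ, a ξ) := rfl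
  have n1 : wNorm ε t τ (r - 1 / 2) (fun _ => 1)
      (fun ξ y => ((χ y : ℝ) : ℂ) * deriv (w ξ) y) = Real.sqrt (∫ ξ, ∫ y, U1 ξ y ∂ν) := rfl
  have n2 : wNorm ε t τ (r - 1 / 2) (fun _ => 1)
      (fun ξ y => ((y * χ y : ℝ) : ℂ) * deriv (w ξ) y) = Real.sqrt (∫ ξ, ∫ y, V2 ξ y ∂ν) := rfl
  have n3 : wNorm ε t τ (r - 1 / 2) (fun _ => 1)
      (fun ξ y => ((χ y : ℝ) : ℂ) * deriv (deriv (w ξ)) y) =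
        Real.sqrt (∫ ξ, ∫ y, U2 ξ y ∂ν) := rfl
  rw [hA', n1, n2, n3]
  have hpos : ∀ᵐ q : ℝ × ℝ × ℝ ∂((volume : Measure ℝ).prod ((volume : Measure ℝ).prod ν)),
      0 < q.2.2 := by
    have h0 : ∀ᵐ y ∂ν, 0 < y := ae_restrict_mem measurableSet_Ioi
    have q2 : Measure.QuasiMeasurePreserving (fun q : ℝ × ℝ × ℝ => q.2.2)
        ((volume : Measure ℝ).prod ((volume : Measure ℝ).prod ν)) ν :=
      Measure.quasiMeasurePreserving_snd.comp Measure.quasiMeasurePreserving_snd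
    exact q2.ae h0
  have key := lintegral_mono_ae (μ := (volume : Measure ℝ).prod ((volume : Measure ℝ).prod ν))
    (f := fun q : ℝ × ℝ × ℝ => ‖((q.2.1 : ℂ) * A q.2.1 * ((theta ε t q.2.1 q.2.2 : ℝ) : ℂ) *
              deriv (w (q.1 - q.2.1)) q.2.2
            + (q.2.1 : ℂ) * A q.2.1 * ((IyR (theta ε t q.2.1) q.2.2 : ℝ) : ℂ) *
              deriv (deriv (w (q.1 - q.2.1))) q.2.2) *
          (starRingEnd ℂ) (deriv (w q.1) q.2.2) *
          (((χ q.2.2) ^ 2 * wgt ε t τ (r - 1 / 2) q.1 q.2.2 : ℝ) : ℂ)‖ₑ)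
    (g := fun q : ℝ × ℝ × ℝ =>
      ENNReal.ofReal (Real.sqrt (kern (2 * (r - 1 / 2)) q.1 q.2.1 * U1 q.1 q.2.2) *
        Real.sqrt (a q.2.1 * U1 (q.1 - q.2.1) q.2.2)) +
      ENNReal.ofReal (Real.sqrt (kern (2 * (r - 1 / 2)) q.1 q.2.1 * V2 q.1 q.2.2) *
        Real.sqrt (a q.2.1 * U2 (q.1 - q.2.1) q.2.2))) (by
      filter_upwards [hpos] with q hq
      obtain ⟨ξ, η, y⟩ := q
      simp only at hq ⊢
      rw [← ENNReal.ofReal_add (by positivity) (by positivity), ← ofReal_norm]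
      apply ENNReal.ofReal_le_ofReal
      have hw := wgt_le r τ ξ η hr hτ ε t y
      have W0 := wgt_nonneg ε t τ (r - 1 / 2) ξ y
      have W1 := wgt_nonneg ε t τ (r - 1 / 2) (ξ - η) y
      have a0 := aWgt_nonneg τ r η
      have k0 := kern_nonneg (2 * (r - 1 / 2)) ξ η
      have x0 := (hχ y).1
      have p1 := pt _ _ _ _ |η| ‖A η‖ ‖deriv (w (ξ - η)) y‖ ‖deriv (w ξ) y‖ (χ y) (χ y) k0 a0 W0 W1
        (abs_nonneg _) (norm_nonneg _) (norm_nonneg _) (norm_nonneg _) x0 x0 hw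
      have p2 := pt _ _ _ _ |η| ‖A η‖ ‖deriv (deriv (w (ξ - η))) y‖ ‖deriv (w ξ) y‖ (χ y) (y * χ y)
        k0 a0 W0 W1
        (abs_nonneg _) (norm_nonneg _) (norm_nonneg _) (norm_nonneg _) x0 (by positivity) hw
      simp only [hU1, hU2, hV2, ha, norm_mul, Complex.norm_real, Real.norm_eq_abs, abs_of_nonneg x0,
        abs_of_pos hq, RCLike.norm_conj, abs_mul, abs_pow, abs_of_nonneg W0] at p1 p2 ⊢
      refine le_trans ?_ (add_le_add p1 p2)
      have t1 := theta_bd ε t η y hε ht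
      have t2 := Iy_bd ε t η y hε ht hq
      calc _ ≤ (|η| * ‖A η‖ * 1 * ‖deriv (w (ξ - η)) y‖ +
            |η| * ‖A η‖ * y * ‖deriv (deriv (w (ξ - η))) y‖) * ‖deriv (w ξ) y‖ *
              (χ y ^ 2 * wgt ε t τ (r - 1 / 2) ξ y) := by
            gcongr
            refine (norm_add_le _ _).trans ?_
            simp only [norm_mul, Complex.norm_real, Real.norm_eq_abs]
            gcongr
        _ = _ := by ring)
  have hsum : ‖∫ ξ : ℝ, ∫ y in Ioi (0 : ℝ),
          dyMcal ε t w A ξ y * (starRingEnd ℂ) (deriv (w ξ) y) *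
            (((χ y) ^ 2 * wgt ε t τ (r - 1 / 2) ξ y : ℝ) : ℂ)‖ₑ ≤ ∫⁻ q : ℝ × ℝ × ℝ,
      (ENNReal.ofReal (Real.sqrt (kern (2 * (r - 1 / 2)) q.1 q.2.1 * U1 q.1 q.2.2) *
        Real.sqrt (a q.2.1 * U1 (q.1 - q.2.1) q.2.2)) +
      ENNReal.ofReal (Real.sqrt (kern (2 * (r - 1 / 2)) q.1 q.2.1 * V2 q.1 q.2.2) *
        Real.sqrt (a q.2.1 * U2 (q.1 - q.2.1) q.2.2)))
        ∂((volume : Measure ℝ).prod ((volume : Measure ℝ).prod ν)) := by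
    have e : ∀ ξ y, dyMcal ε t w A ξ y * (starRingEnd ℂ) (deriv (w ξ) y) *
            (((χ y) ^ 2 * wgt ε t τ (r - 1 / 2) ξ y : ℝ) : ℂ) = -Complex.I * ∫ η : ℝ,
          ((η : ℂ) * A η * ((theta ε t η y : ℝ) : ℂ) * deriv (w (ξ - η)) y
      + (η : ℂ) * A η * ((IyR (theta ε t η) y : ℝ) : ℂ) * deriv (deriv (w (ξ - η))) y) *
          (starRingEnd ℂ) (deriv (w ξ) y) *
          (((χ y) ^ 2 * wgt ε t τ (r - 1 / 2) ξ y : ℝ) : ℂ) := by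
      intro ξ y
      rw [integral_mul_const, integral_mul_const, dyMcal]
      ring
    simp only [e]
    exact hn.trans key
  have hm : AEMeasurable (fun q : ℝ × ℝ × ℝ =>
      ENNReal.ofReal (Real.sqrt (kern (2 * (r - 1 / 2)) q.1 q.2.1 * U1 q.1 q.2.2) *
        Real.sqrt (a q.2.1 * U1 (q.1 - q.2.1) q.2.2)))
      ((volume : Measure ℝ).prod ((volume : Measure ℝ).prod ν)) :=
    core_meas _ (kern_cont _) a hA ν U1 U1 hw1 hw1
  rw [lintegral_add_left' hm] at hsum
  have hfin := hsum.trans (add_le_add c1 c2)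
  rw [← ENNReal.ofReal_add (by positivity) (by positivity), ← ofReal_norm,
    ENNReal.ofReal_le_ofReal_iff (by positivity)] at hfin
  refine hfin.trans ?_
  have s0 := Real.sqrt_nonneg M
  have s1 := Real.sqrt_nonneg (∫ ξ, ∫ y, U1 ξ y ∂ν)
  have s2 := Real.sqrt_nonneg (∫ ξ, ∫ y, U2 ξ y ∂ν)
  have s3 := Real.sqrt_nonneg (∫ ξ, ∫ y, V2 ξ y ∂ν)
  have s4 := Real.sqrt_nonneg (∫ ξ, a ξ)
  generalize Real.sqrt (∫ ξ, ∫ y, U1 ξ y ∂ν) = x1 at *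
  generalize Real.sqrt (∫ ξ, ∫ y, U2 ξ y ∂ν) = x2 at *
  generalize Real.sqrt (∫ ξ, ∫ y, V2 ξ y ∂ν) = x3 at *
  generalize Real.sqrt (∫ ξ, a ξ) = x4 at *
  generalize Real.sqrt M = x0 at *
  have z : 0 ≤ x1 ^ 2 * x4 + x3 * x2 * x4 := by positivity
  linarith
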